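/- Let c_1, c_2, d_1, d_2 be positive real numbers with c_2 ≥ c_1 and d_2 ≥ d_1. Then there exists a strictly positive (positive definite) real 4×4 matrix γ whose 2×2 main diagonal blocks are diag(c_1, c_1) and diag(c_2, c_2) and whose symplectic eigenvalues are (d_1, d_2) if and only if c_1 + c_2 ≥ d_1 + d_2 and c_2 − c_1 ≤ d_2 − d_1. -/

import Mathlib

open Matrix Finset ComplexOrder

/-- The standard symplectic form on `2n` modes: block diagonal with
`n` blocks `[[0,1],[-1,0]]`. -/
def OmegaMat (n : ℕ) : Matrix (Fin (2*n)) (Fin (2*n)) ℝ :=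
  fun i j =>
    if i.val % 2 = 0 ∧ j.val = i.val + 1 then 1
    else if j.val % 2 = 0 ∧ i.val = j.val + 1 then -1
    else 0

/-- Membership in the real symplectic group `Sp(2n, ℝ)`. -/
def IsSymplectic {n : ℕ} (S : Matrix (Fin (2*n)) (Fin (2*n)) ℝ) : Prop :=
  S * OmegaMat n * S.transpose = OmegaMat n

/-- The Williamson diagonal matrix `diag(d₁,d₁,…,d_n,d_n)`. -/
def sympDiag {n : ℕ} (d : Fin n → ℝ) : Matrix (Fin (2*n)) (Fin (2*n)) ℝ :=
  Matrix.diagonal (fun i => d ⟨i.val / 2, by have := i.isLt; omega⟩)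

/-- `γ` has symplectic eigenvalues `(d₁,…,d_n)`:
there is `S ∈ Sp(2n,ℝ)` with `S γ Sᵀ = diag(d₁,d₁,…,d_n,d_n)`. -/
def HasSympEigenvalues {n : ℕ} (γ : Matrix (Fin (2*n)) (Fin (2*n)) ℝ)
    (d : Fin n → ℝ) : Prop :=
  ∃ S : Matrix (Fin (2*n)) (Fin (2*n)) ℝ,
    IsSymplectic S ∧ S * γ * S.transpose = sympDiag d

/-- Index `2j` in `Fin (2n)` (row/column of the first entry of mode `j`). -/
def modeIdx1 {n : ℕ} (j : Fin n) : Fin (2*n) :=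
  ⟨2 * j.val, by have := j.isLt; omega⟩

/-- Index `2j+1` in `Fin (2n)` (row/column of the second entry of mode `j`). -/
def modeIdx2 {n : ℕ} (j : Fin n) : Fin (2*n) :=
  ⟨2 * j.val + 1, by have := j.isLt; omega⟩

/-- The `j`-th symplectic main diagonal element of `γ`:
the symplectic eigenvalue of the `j`-th `2×2` main diagonal block,
`c_j = (γ_{2j-1,2j-1} γ_{2j,2j} - γ_{2j-1,2j}²)^{1/2}`. -/
noncomputable def sympMainDiag {n : ℕ} (γ : Matrix (Fin (2*n)) (Fin (2*n)) ℝ)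
    (j : Fin n) : ℝ :=
  Real.sqrt (γ (modeIdx1 j) (modeIdx1 j) * γ (modeIdx2 j) (modeIdx2 j)
    - (γ (modeIdx1 j) (modeIdx2 j))^2)

/-- `γ` is a covariance matrix of `n` modes: the complex Hermitian matrix
`γ + iσ` is positive semidefinite. -/
def IsCovarianceMatrix {n : ℕ} (γ : Matrix (Fin (2*n)) (Fin (2*n)) ℝ) : Prop :=
  (γ.map (fun x => (x : ℂ)) + Complex.I • (OmegaMat n).map (fun x => (x : ℂ))).PosSemidef

/-- `γ` is the covariance matrix of a pure Gaussian state of `n` modes: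
`γ = S Sᵀ` for some `S ∈ Sp(2n,ℝ)`. -/
def IsPureCovarianceMatrix {n : ℕ} (γ : Matrix (Fin (2*n)) (Fin (2*n)) ℝ) : Prop :=
  ∃ S : Matrix (Fin (2*n)) (Fin (2*n)) ℝ, IsSymplectic S ∧ γ = S * S.transpose

lemma eig2 (x y z s t : ℝ) (h1 : x + z = s + t) (h2 : x * z - y ^ 2 = s * t) :
    ∃ u v : ℝ, u ^ 2 + v ^ 2 = 1 ∧ x * u + y * v = s * u ∧ y * u + z * v = s * v ∧
      -x * v + y * u = -t * v ∧ -y * v + z * u = t * u := by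
  by_cases h : y ^ 2 + (s - x) ^ 2 = 0
  · have hy : y = 0 := by nlinarith [sq_nonneg y, sq_nonneg (s - x)]
    have hx : s - x = 0 := by nlinarith [sq_nonneg y, sq_nonneg (s - x)]
    refine ⟨1, 0, ?_, ?_, ?_, ?_, ?_⟩ <;> subst hy <;> linarith
  · have hn : 0 < y ^ 2 + (s - x) ^ 2 := lt_of_le_of_ne (by positivity) (Ne.symm h)
    obtain ⟨n, hn0, hn2⟩ : ∃ n : ℝ, n ≠ 0 ∧ n ^ 2 = y ^ 2 + (s - x) ^ 2 :=
      ⟨√(y ^ 2 + (s - x) ^ 2), (Real.sqrt_pos.2 hn).ne', Real.sq_sqrt hn.le⟩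
    have hz : z = s + t - x := by linarith
    subst hz
    refine ⟨y / n, (s - x) / n, ?_, ?_, ?_, ?_, ?_⟩
    · field_simp; linarith
    all_goals field_simp
    all_goals nlinarith

lemma omega_two : OmegaMat 2 = (!![0,1,0,0; -1,0,0,0; 0,0,0,1; 0,0,-1,0] : Matrix (Fin 4) (Fin 4) ℝ) := by
  ext i j
  fin_cases i <;> fin_cases j <;> simp [OmegaMat]

lemma sympDiag_two (d₁ d₂ : ℝ) : sympDiag ![d₁, d₂] =
    (!![d₁,0,0,0; 0,d₁,0,0; 0,0,d₂,0; 0,0,0,d₂] : Matrix (Fin 4) (Fin 4) ℝ) := by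
  ext i j
  fin_cases i <;> fin_cases j <;> simp [sympDiag, Matrix.diagonal]

lemma build (c₁ c₂ d₁ d₂ e f a b c d p q r s : ℝ)
    (h1 : a * p + b * q = 1) (h2 : a * r + b * s = 0) (h3 : c * p + d * q = 0)
    (h4 : c * r + d * s = 1)
    (k1 : a * (c₁ * a + e * b) + b * (e * a + c₂ * b) = d₁)
    (k2 : a * (c₁ * c + e * d) + b * (e * c + c₂ * d) = 0)
    (k3 : c * (c₁ * c + e * d) + d * (e * c + c₂ * d) = d₂)
    (l1 : p * (c₁ * p + f * q) + q * (f * p + c₂ * q) = d₁)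
    (l2 : p * (c₁ * r + f * s) + q * (f * r + c₂ * s) = 0)
    (l3 : r * (c₁ * r + f * s) + s * (f * r + c₂ * s) = d₂) :
    HasSympEigenvalues (n := 2)
      (!![c₁,0,e,0; 0,c₁,0,f; e,0,c₂,0; 0,f,0,c₂] : Matrix (Fin 4) (Fin 4) ℝ) ![d₁, d₂] := by
  refine ⟨(!![a,0,b,0; 0,p,0,q; c,0,d,0; 0,r,0,s] : Matrix (Fin 4) (Fin 4) ℝ), ?_, ?_⟩
  · unfold IsSymplectic
    rw [omega_two]
    change (_ : Matrix (Fin 4) (Fin 4) ℝ) * _ * Matrix.transpose _ = _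
    ext i j
    fin_cases i <;> fin_cases j <;> simp [Matrix.mul_apply, Fin.sum_univ_four] <;> linarith
  · rw [sympDiag_two]
    change (_ : Matrix (Fin 4) (Fin 4) ℝ) * _ * Matrix.transpose _ = _
    ext i j
    fin_cases i <;> fin_cases j <;> simp [Matrix.mul_apply, Fin.sum_univ_four] <;> linarith

lemma bwd (c₁ c₂ d₁ d₂ e f : ℝ) (hc₁ : 0 < c₁) (hd₁ : 0 < d₁) (hd₂ : 0 < d₂)
    (he : e ^ 2 < c₁ * c₂)
    (h1 : c₁ ^ 2 + c₂ ^ 2 + 2 * (e * f) = d₁ ^ 2 + d₂ ^ 2)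
    (h2 : (c₁ * c₂ - e ^ 2) * (c₁ * c₂ - f ^ 2) = d₁ ^ 2 * d₂ ^ 2) :
    HasSympEigenvalues (n := 2)
      (!![c₁,0,e,0; 0,c₁,0,f; e,0,c₂,0; 0,f,0,c₂] : Matrix (Fin 4) (Fin 4) ℝ) ![d₁, d₂] := by
  obtain ⟨a, ha, ha2⟩ : ∃ a : ℝ, 0 < a ∧ c₁ = a ^ 2 :=
    ⟨√c₁, Real.sqrt_pos.2 hc₁, (Real.sq_sqrt hc₁.le).symm⟩
  obtain ⟨b, hb⟩ : ∃ b : ℝ, e = a * b := ⟨e / a, by field_simp⟩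
  obtain ⟨h, hh, hh2⟩ : ∃ h : ℝ, 0 < h ∧ c₂ = b ^ 2 + h ^ 2 := by
    have : 0 < c₂ - b ^ 2 := by
      subst ha2 hb
      have : 0 < a ^ 2 * (c₂ - b ^ 2) := by nlinarith
      exact (pos_iff_pos_of_mul_pos this).1 (by positivity)
    exact ⟨√(c₂ - b ^ 2), Real.sqrt_pos.2 this, by rw [Real.sq_sqrt this.le]; ring⟩
  obtain ⟨s, hs, hs2⟩ : ∃ s : ℝ, 0 < s ∧ d₁ = s ^ 2 :=
    ⟨√d₁, Real.sqrt_pos.2 hd₁, (Real.sq_sqrt hd₁.le).symm⟩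
  obtain ⟨t, ht, ht2⟩ : ∃ t : ℝ, 0 < t ∧ d₂ = t ^ 2 :=
    ⟨√d₂, Real.sqrt_pos.2 hd₂, (Real.sq_sqrt hd₂.le).symm⟩
  obtain ⟨u, v, n1, e1, e2, e3, e4⟩ := eig2 (c₁ * a ^ 2 + 2 * f * a * b + c₂ * b ^ 2)
    (f * a * h + c₂ * b * h) (c₂ * h ^ 2) (d₁ ^ 2) (d₂ ^ 2)
    (by rw [← h1, ha2, hb, hh2]; ring) (by rw [← h2, ha2, hb, hh2]; ring)
  have ha' := ha.ne'
  have hh' := hh.ne'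
  have hs' := hs.ne'
  have ht' := ht.ne'
  refine build c₁ c₂ d₁ d₂ e f (s * (u / a - v * b / (a * h))) (s * (v / h))
    (t * (-v / a - u * b / (a * h))) (t * (u / h))
    (u * a / s) ((u * b + v * h) / s) (-v * a / t) ((-v * b + u * h) / t)
    ?_ ?_ ?_ ?_ ?_ ?_ ?_ ?_ ?_ ?_
  · field_simp; linear_combination h * n1
  · field_simp; ring
  · field_simp; ring
  · field_simp; linear_combination h * n1
  · rw [ha2, hb, hh2, hs2]; field_simp; linear_combination h ^ 2 * n1
  · rw [ha2, hb, hh2]; field_simp; ring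
  · rw [ha2, hb, hh2, ht2]; field_simp; linear_combination h ^ 2 * n1
  · have : d₁ = d₁ ^ 2 / s ^ 2 := by rw [hs2]; field_simp
    rw [this]; field_simp; linear_combination u * e1 + v * e2 + d₁ ^ 2 * n1
  · field_simp; linear_combination u * e3 + v * e4
  · have : d₂ = d₂ ^ 2 / t ^ 2 := by rw [ht2]; field_simp
    rw [this]; field_simp; linear_combination -v * e3 + u * e4 + d₂ ^ 2 * n1

lemma quadpos (c₁ c₂ e x y : ℝ) (hc₁ : 0 < c₁) (he : e ^ 2 < c₁ * c₂) (h : x ≠ 0 ∨ y ≠ 0) :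
    0 < c₁ * x ^ 2 + 2 * e * x * y + c₂ * y ^ 2 := by
  have key : 0 < c₁ * (c₁ * x ^ 2 + 2 * e * x * y + c₂ * y ^ 2) := by
    have : c₁ * (c₁ * x ^ 2 + 2 * e * x * y + c₂ * y ^ 2)
      = (c₁ * x + e * y) ^ 2 + (c₁ * c₂ - e ^ 2) * y ^ 2 := by ring
    rw [this]
    have h3 : 0 < c₁ * c₂ - e ^ 2 := by linarith
    by_cases hy : y = 0
    · subst hy
      have : x ≠ 0 := by simpa using h
      simp; positivity
    · positivity
  exact (pos_iff_pos_of_mul_pos key).1 hc₁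

lemma posdef (c₁ c₂ e f : ℝ) (hc₁ : 0 < c₁) (he : e ^ 2 < c₁ * c₂) (hf : f ^ 2 < c₁ * c₂) :
    (!![c₁,0,e,0; 0,c₁,0,f; e,0,c₂,0; 0,f,0,c₂] : Matrix (Fin 4) (Fin 4) ℝ).PosDef := by
  refine Matrix.PosDef.of_dotProduct_mulVec_pos ?_ ?_
  · ext i j
    fin_cases i <;> fin_cases j <;> simp
  · intro x hx
    have e1 : star x ⬝ᵥ ((!![c₁,0,e,0; 0,c₁,0,f; e,0,c₂,0; 0,f,0,c₂] : Matrix (Fin 4) (Fin 4) ℝ) *ᵥ x)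
      = (c₁ * x 0 ^ 2 + 2 * e * x 0 * x 2 + c₂ * x 2 ^ 2)
        + (c₁ * x 1 ^ 2 + 2 * f * x 1 * x 3 + c₂ * x 3 ^ 2) := by
      simp [dotProduct, Matrix.mulVec, Fin.sum_univ_four]
      ring
    rw [e1]
    have nn : ∀ g y z : ℝ, g ^ 2 < c₁ * c₂ → 0 ≤ c₁ * y ^ 2 + 2 * g * y * z + c₂ * z ^ 2 := by
      intro g y z hg
      by_cases h : y ≠ 0 ∨ z ≠ 0
      · exact (quadpos c₁ c₂ g y z hc₁ hg h).le
      · push Not at h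
        simp [h.1, h.2]
    by_cases h : x 0 ≠ 0 ∨ x 2 ≠ 0
    · have := quadpos c₁ c₂ e _ _ hc₁ he h
      linarith [nn f (x 1) (x 3) hf]
    · by_cases h' : x 1 ≠ 0 ∨ x 3 ≠ 0
      · have := quadpos c₁ c₂ f _ _ hc₁ hf h'
        linarith [nn e (x 0) (x 2) he]
      · push Not at h h'
        exact absurd (by ext i; fin_cases i <;> simp [h, h']) hx

lemma invariants (γ : Matrix (Fin 4) (Fin 4) ℝ) (d₁ d₂ : ℝ)
    (h : HasSympEigenvalues (n := 2) γ ![d₁, d₂]) :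
    γ.det = d₁ ^ 2 * d₂ ^ 2 ∧
    (!![0,1,0,0; -1,0,0,0; 0,0,0,1; 0,0,-1,0] * γ * !![0,1,0,0; -1,0,0,0; 0,0,0,1; 0,0,-1,0] * γ).trace
      = -2 * (d₁ ^ 2 + d₂ ^ 2) := by
  obtain ⟨S, hS, hD⟩ := h
  change Matrix (Fin 4) (Fin 4) ℝ at S
  unfold IsSymplectic at hS
  rw [omega_two] at hS
  rw [sympDiag_two] at hD
  change (_ : Matrix (Fin 4) (Fin 4) ℝ) * _ * Matrix.transpose _ = _ at hS
  change (_ : Matrix (Fin 4) (Fin 4) ℝ) * _ * Matrix.transpose _ = _ at hD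
  set W : Matrix (Fin 4) (Fin 4) ℝ := !![0,1,0,0; -1,0,0,0; 0,0,0,1; 0,0,-1,0] with hW
  set D : Matrix (Fin 4) (Fin 4) ℝ := !![d₁,0,0,0; 0,d₁,0,0; 0,0,d₂,0; 0,0,0,d₂] with hDD
  have W2 : W * W = -1 := by
    ext i j
    fin_cases i <;> fin_cases j <;> simp [hW, Matrix.mul_apply, Fin.sum_univ_four]
  have detW : W.det = 1 := by
    simp [hW, Matrix.det_succ_row_zero, Fin.sum_univ_succ, Fin.succAbove]
  have detD : D.det = d₁ ^ 2 * d₂ ^ 2 := by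
    simp [hDD, Matrix.det_succ_row_zero, Fin.sum_univ_succ, Fin.succAbove]
    ring
  have detS : S.det * S.det = 1 := by
    have := congrArg Matrix.det hS
    rw [Matrix.det_mul, Matrix.det_mul, Matrix.det_transpose, detW] at this
    linarith
  constructor
  · have := congrArg Matrix.det hD
    rw [Matrix.det_mul, Matrix.det_mul, Matrix.det_transpose, detD] at this
    linear_combination this - γ.det * detS
  · have i1 : S * (W * Sᵀ * (-W)) = 1 := by
      calc S * (W * Sᵀ * (-W)) = (S * W * Sᵀ) * (-W) := by simp only [Matrix.mul_assoc]
        _ = 1 := by rw [hS, mul_neg, W2, neg_neg]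
    have i2 := mul_eq_one_comm.1 i1
    have hS' : Sᵀ * W * S = W := by
      calc Sᵀ * W * S = -(W * W) * (Sᵀ * W * S) := by rw [W2]; simp
        _ = W * ((W * Sᵀ * (-W)) * S) := by simp [Matrix.mul_assoc]
        _ = W := by rw [i2, mul_one]
    have : (W * D * W * D).trace = (W * γ * W * γ).trace := by
      rw [← hD]
      calc (W * (S * γ * Sᵀ) * W * (S * γ * Sᵀ)).trace
          = ((W * S * γ * (Sᵀ * W * S) * γ) * Sᵀ).trace := by simp only [Matrix.mul_assoc]
        _ = (Sᵀ * (W * S * γ * (Sᵀ * W * S) * γ)).trace := Matrix.trace_mul_comm _ _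
        _ = ((Sᵀ * W * S) * γ * (Sᵀ * W * S) * γ).trace := by simp only [Matrix.mul_assoc]
        _ = _ := by rw [hS']
    rw [← this]
    simp [hW, hDD, Matrix.trace, Matrix.mul_apply, Fin.sum_univ_four]
    ring

lemma absle {x y k m : ℝ} (hx : 0 ≤ x) (hy : 0 ≤ y) (h : x ^ 2 ≤ y ^ 2) (h2 : y = m - k) : x + k ≤ m := by
  have := (sq_le_sq₀ hx hy).1 h
  linarith

set_option maxHeartbeats 1000000 in
/-- **Lemma 5 (Solution to the two-mode problem).** For positive reals with
`c₂ ≥ c₁` and `d₂ ≥ d₁`, a strictly positive real `4×4` matrix `γ` with `2×2`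
main diagonal blocks `diag(c₁,c₁)` and `diag(c₂,c₂)` and symplectic eigenvalues
`(d₁,d₂)` exists iff `c₁ + c₂ ≥ d₁ + d₂` and `c₂ - c₁ ≤ d₂ - d₁`. -/
theorem two_mode_problem (c₁ c₂ d₁ d₂ : ℝ)
    (hc₁ : 0 < c₁) (hc₂ : 0 < c₂) (hd₁ : 0 < d₁) (hd₂ : 0 < d₂)
    (hc : c₁ ≤ c₂) (hd : d₁ ≤ d₂) :
    (∃ γ : Matrix (Fin 4) (Fin 4) ℝ, γ.PosDef ∧
        γ 0 0 = c₁ ∧ γ 1 1 = c₁ ∧ γ 0 1 = 0 ∧ γ 1 0 = 0 ∧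
        γ 2 2 = c₂ ∧ γ 3 3 = c₂ ∧ γ 2 3 = 0 ∧ γ 3 2 = 0 ∧
        HasSympEigenvalues (n := 2) γ ![d₁, d₂]) ↔
      (d₁ + d₂ ≤ c₁ + c₂ ∧ c₂ - c₁ ≤ d₂ - d₁) := by
  constructor
  · rintro ⟨γ, hγ, h00, h11, h01, h10, h22, h33, h23, h32, hs⟩
    obtain ⟨hdet, htr⟩ := invariants γ d₁ d₂ hs
    have sym : ∀ i j, γ i j = γ j i := fun i j => by simpa using (hγ.1.apply i j).symm
    obtain ⟨a, ha⟩ : ∃ a, γ 0 2 = a := ⟨_, rfl⟩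
    obtain ⟨b, hb⟩ : ∃ b, γ 0 3 = b := ⟨_, rfl⟩
    obtain ⟨c, hc'⟩ : ∃ c, γ 1 2 = c := ⟨_, rfl⟩
    obtain ⟨d, hd'⟩ : ∃ d, γ 1 3 = d := ⟨_, rfl⟩
    have ha' : γ 2 0 = a := by rw [sym, ha]
    have hb' : γ 3 0 = b := by rw [sym, hb]
    have hc'' : γ 2 1 = c := by rw [sym, hc']
    have hd'' : γ 3 1 = d := by rw [sym, hd']
    have hγe : γ = !![c₁,0,a,b; 0,c₁,c,d; a,c,c₂,0; b,d,0,c₂] := by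
      ext i j
      fin_cases i <;> fin_cases j <;> simp [*]
    have p1 : a ^ 2 + c ^ 2 < c₁ * c₂ := by
      have := hγ.dotProduct_mulVec_pos (x := ![a, c, -c₁, 0])
        (fun h => by have := congrFun h 2; simp at this; exact hc₁.ne' this)
      simp [hγe, dotProduct, Matrix.mulVec, Fin.sum_univ_four] at this
      have : 0 < c₁ * (c₁ * c₂ - (a ^ 2 + c ^ 2)) := by linarith
      linarith [(pos_iff_pos_of_mul_pos this).1 hc₁]
    have p2 : b ^ 2 + d ^ 2 < c₁ * c₂ := by
      have := hγ.dotProduct_mulVec_pos (x := ![b, d, 0, -c₁])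
        (fun h => by have := congrFun h 3; simp at this; exact hc₁.ne' this)
      simp [hγe, dotProduct, Matrix.mulVec, Fin.sum_univ_four] at this
      have : 0 < c₁ * (c₁ * c₂ - (b ^ 2 + d ^ 2)) := by linarith
      linarith [(pos_iff_pos_of_mul_pos this).1 hc₁]
    have i1 : (c₁ * c₂) ^ 2 - c₁ * c₂ * (a ^ 2 + b ^ 2 + c ^ 2 + d ^ 2) + (a * d - b * c) ^ 2
        = (d₁ * d₂) ^ 2 := by
      rw [mul_pow d₁, ← hdet, hγe]
      simp [Matrix.det_succ_row_zero, Fin.sum_univ_succ, Fin.succAbove]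
      ring
    have i2 : c₁ ^ 2 + c₂ ^ 2 + 2 * (a * d - b * c) = d₁ ^ 2 + d₂ ^ 2 := by
      rw [hγe] at htr
      simp [Matrix.trace, Matrix.mul_apply, Fin.sum_univ_four] at htr
      linarith
    have m : 0 < c₁ * c₂ := by positivity
    have md : 0 < d₁ * d₂ := by positivity
    have q1 : d₁ * d₂ + (a * d - b * c) ≤ c₁ * c₂ := by
      refine absle md.le (y := c₁ * c₂ - (a * d - b * c)) ?_ ?_ rfl
      · linarith [sq_nonneg (a - d), sq_nonneg (b + c)]
      · rw [← i1]
        linarith [mul_nonneg m.le (sq_nonneg (a - d)), mul_nonneg m.le (sq_nonneg (b + c))]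
    have q2 : d₁ * d₂ + -(a * d - b * c) ≤ c₁ * c₂ := by
      refine absle md.le (y := c₁ * c₂ - -(a * d - b * c)) ?_ ?_ rfl
      · linarith [sq_nonneg (a + d), sq_nonneg (b - c)]
      · rw [← i1]
        linarith [mul_nonneg m.le (sq_nonneg (a + d)), mul_nonneg m.le (sq_nonneg (b - c))]
    constructor
    · refine (sq_le_sq₀ (by linarith) (by linarith)).1 ?_
      nlinarith
    · refine (sq_le_sq₀ (by linarith) (by linarith)).1 ?_
      nlinarith
  · rintro ⟨h1, h2⟩
    have m : 0 < c₁ * c₂ := by positivity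
    have md : 0 < d₁ * d₂ := by positivity
    have s1 := (sq_le_sq₀ (by linarith) (by linarith)).2 h1
    have s2 := (sq_le_sq₀ (by linarith) (by linarith)).2 h2
    obtain ⟨k, hk⟩ : ∃ k, k = (d₁ ^ 2 + d₂ ^ 2 - c₁ ^ 2 - c₂ ^ 2) / 2 := ⟨_, rfl⟩
    have q1 : d₁ * d₂ ≤ c₁ * c₂ - k := by nlinarith
    have q2 : d₁ * d₂ ≤ c₁ * c₂ + k := by nlinarith
    obtain ⟨t, ht⟩ : ∃ t, c₁ * c₂ * t = (c₁ * c₂) ^ 2 + k ^ 2 - (d₁ * d₂) ^ 2 :=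
      ⟨((c₁ * c₂) ^ 2 + k ^ 2 - (d₁ * d₂) ^ 2) / (c₁ * c₂), by field_simp⟩
    have r1 := (sq_le_sq₀ md.le (by linarith)).2 q1
    have r2 := (sq_le_sq₀ md.le (by linarith)).2 q2
    have t1 : 0 ≤ t - 2 * k := by
      have : 0 ≤ c₁ * c₂ * (t - 2 * k) := by nlinarith
      exact nonneg_of_mul_nonneg_right this m
    have t2 : 0 ≤ t + 2 * k := by
      have : 0 ≤ c₁ * c₂ * (t + 2 * k) := by nlinarith
      exact nonneg_of_mul_nonneg_right this m
    have t3 : t < 2 * (c₁ * c₂) := by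
      have : 0 < c₁ * c₂ * (2 * (c₁ * c₂) - t) := by
        have : 0 < (c₁ * c₂ - k) * (c₁ * c₂ + k) := mul_pos (by linarith) (by linarith)
        have : 0 < (d₁ * d₂) ^ 2 := by positivity
        nlinarith
      linarith [(pos_iff_pos_of_mul_pos this).1 m]
    obtain ⟨e, f, hef, hs⟩ : ∃ e f : ℝ, e * f = k ∧ e ^ 2 + f ^ 2 = t := by
      have w1 := Real.sq_sqrt t1
      have w2 := Real.sq_sqrt t2
      refine ⟨(√(t + 2 * k) + √(t - 2 * k)) / 2, (√(t + 2 * k) - √(t - 2 * k)) / 2, ?_, ?_⟩ <;>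
        linarith
    have hdd : (c₁ * c₂ - e ^ 2) * (c₁ * c₂ - f ^ 2) = d₁ ^ 2 * d₂ ^ 2 := by
      rw [← hs, ← hef] at ht
      linarith
    have hpos : 0 < (c₁ * c₂ - e ^ 2) * (c₁ * c₂ - f ^ 2) := by rw [hdd]; positivity
    have he : e ^ 2 < c₁ * c₂ := by
      by_contra hcon
      have : c₁ * c₂ - f ^ 2 > 0 := by linarith
      nlinarith
    have hf : f ^ 2 < c₁ * c₂ := by
      linarith [(pos_iff_pos_of_mul_pos hpos).1 (by linarith)]
    exact ⟨_, posdef c₁ c₂ e f hc₁ he hf, by simp, by simp, by simp, by simp, by simp, by simp,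
      by simp, by simp, bwd c₁ c₂ d₁ d₂ e f hc₁ hd₁ hd₂ he (by rw [hef, hk]; ring) hdd⟩
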